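/- Let T be a tree on a finite set I, and let F₁, F₂ be forests on I with F₁ ⊆ T, F₂ ⊆ T and N(F₁) ∩ N(F₂) = ∅. Then there exists a forest F on I with F ⊆ T such that F₁ ⊆ F, F₂ ⊆ F, N(F) = N(F₁) ∪ N(F₂), and F ⊆ G for every forest G ⊆ T satisfying F₁ ⊆ G and F₂ ⊆ G; i.e. the supremum of F₁ and F₂ in the lattice of forests ⊆ T exists and its set of nodes is the disjoint union N(F₁) ⊔ N(F₂). -/

import Mathlib

/-- A forest on `I`: a partial order on `I` such that the set of elements below any
element is totally ordered (a chain). -/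
structure Forest (I : Type*) where
  le : I → I → Prop
  le_refl : ∀ i, le i i
  le_trans : ∀ ⦃i j k⦄, le i j → le j k → le i k
  le_antisymm : ∀ ⦃i j⦄, le i j → le j i → i = j
  downset_chain : ∀ ⦃i j k⦄, le j i → le k i → le j k ∨ le k j

namespace Forest

variable {I : Type*}

/-- Strict order associated to a forest. -/
def lt (F : Forest I) (i j : I) : Prop := F.le i j ∧ i ≠ j

/-- A root of a forest: a minimal element. -/
def IsRoot (F : Forest I) (r : I) : Prop := ∀ j, F.le j r → j = r

/-- A node of a forest: a vertex which is not a root, i.e. has some vertex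
strictly below it. -/
def IsNode (F : Forest I) (i : I) : Prop := ∃ j, F.lt j i

/-- The set `N(F)` of nodes of a forest. -/
def nodes (F : Forest I) : Set I := {i | F.IsNode i}

/-- `i` and `j` lie in the same block of the partition `π(F)` of `I` associated
to `F`, i.e. they lie above a common root. -/
def sameBlock (F : Forest I) (i j : I) : Prop :=
  ∃ r, F.IsRoot r ∧ F.le r i ∧ F.le r j

/-- The partial order `⊆` on forests: `F' ⊆ F` iff `≤_{F'}` implies `≤_F` and
each tree of `F'` is induced by `F` as a poset (elements of a common block of
`π(F')` that are comparable in `F` are comparable in `F'`). -/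
def Sub (F' F : Forest I) : Prop :=
  (∀ i j, F'.le i j → F.le i j) ∧
  (∀ i j, F'.sameBlock i j → F.le i j → F'.le i j)

/-- A tree is a forest with a (necessarily unique) minimal element lying below
every vertex. -/
def IsTree (T : Forest I) : Prop := ∃ r : I, ∀ i, T.le r i

end Forest

namespace Forest

variable {I : Type*}

theorem sameBlock.symm {F : Forest I} {i j : I} (h : F.sameBlock i j) : F.sameBlock j i := by
  obtain ⟨r, hr, hi, hj⟩ := h
  exact ⟨r, hr, hj, hi⟩

theorem IsRoot.eq_of_le {F : Forest I} {r s i : I} (hr : F.IsRoot r) (hs : F.IsRoot s)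
    (hri : F.le r i) (hsi : F.le s i) : r = s :=
  (F.downset_chain hri hsi).elim (hs r) fun h => (hr s h).symm

theorem sameBlock.trans {F : Forest I} {i j k : I} (hij : F.sameBlock i j)
    (hjk : F.sameBlock j k) : F.sameBlock i k := by
  obtain ⟨r, hr, hri, hrj⟩ := hij
  obtain ⟨s, hs, hsj, hsk⟩ := hjk
  obtain rfl := hr.eq_of_le hs hrj hsj
  exact ⟨r, hr, hri, hsk⟩

theorem exists_isRoot_le [Finite I] (F : Forest I) (i : I) : ∃ r, F.IsRoot r ∧ F.le r i := by
  let _ : PartialOrder I :=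
    { le := F.le, le_refl := F.le_refl, le_trans := fun _ _ _ h h' => F.le_trans h h',
      le_antisymm := fun _ _ h h' => F.le_antisymm h h' }
  obtain ⟨r, hri, hr⟩ := (Set.toFinite (Set.univ : Set I)).exists_le_minimal (Set.mem_univ i)
  exact ⟨r, fun j hj => F.le_antisymm hj (hr.2 (Set.mem_univ j) hj), hri⟩

theorem sameBlock_of_le_of_le [Finite I] {F : Forest I} {i j k : I} (hj : F.le i j)
    (hk : F.le i k) : F.sameBlock j k := by
  obtain ⟨r, hr, hri⟩ := F.exists_isRoot_le i
  exact ⟨r, hr, F.le_trans hri hj, F.le_trans hri hk⟩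

theorem isRoot_of_notMem_nodes {F : Forest I} {i : I} (h : i ∉ F.nodes) : F.IsRoot i :=
  fun j hj => by_contra fun hne => h ⟨j, hj, hne⟩

theorem nodes_subset_of_le {F G : Forest I} (h : ∀ i j, F.le i j → G.le i j) :
    F.nodes ⊆ G.nodes := fun _ ⟨j, hj, hne⟩ => ⟨j, h _ _ hj, hne⟩

/-- The forest obtained from `T` by keeping only the relations inside classes of `r`. -/
def restrict (T : Forest I) (r : Setoid I) : Forest I where
  le i j := r i j ∧ T.le i j
  le_refl i := ⟨r.refl i, T.le_refl i⟩
  le_trans _ _ _ h h' := ⟨r.trans h.1 h'.1, T.le_trans h.2 h'.2⟩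
  le_antisymm _ _ h h' := T.le_antisymm h.2 h'.2
  downset_chain _ _ _ h h' :=
    (T.downset_chain h.2 h'.2).imp (fun hle => ⟨r.trans h.1 (r.symm h'.1), hle⟩)
      fun hle => ⟨r.trans h'.1 (r.symm h.1), hle⟩

theorem rel_of_sameBlock_restrict {T : Forest I} {r : Setoid I} {i j : I}
    (h : (T.restrict r).sameBlock i j) : r i j := by
  obtain ⟨s, -, hi, hj⟩ := h
  exact r.trans (r.symm hi.1) hj.1

theorem restrict_sub (T : Forest I) (r : Setoid I) : (T.restrict r).Sub T :=
  ⟨fun _ _ h => h.2, fun _ _ h hle => ⟨rel_of_sameBlock_restrict h, hle⟩⟩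

theorem Sub.sub_restrict [Finite I] {F T : Forest I} {r : Setoid I} (h : F.Sub T)
    (hr : ∀ i j, F.sameBlock i j → r i j) : F.Sub (T.restrict r) :=
  ⟨fun i j hle => ⟨hr i j (sameBlock_of_le_of_le (F.le_refl i) hle), h.1 i j hle⟩,
    fun i j hb hle => h.2 i j hb hle.2⟩

theorem Sub.sameBlock_mono [Finite I] {F G : Forest I} (h : F.Sub G) {i j : I}
    (hb : F.sameBlock i j) : G.sameBlock i j := by
  obtain ⟨r, -, hi, hj⟩ := hb
  exact sameBlock_of_le_of_le (h.1 _ _ hi) (h.1 _ _ hj)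

theorem Sub.restrict_sub {G T : Forest I} {r : Setoid I} (h : G.Sub T)
    (hr : ∀ i j, r i j → G.sameBlock i j) : (T.restrict r).Sub G :=
  ⟨fun i j hle => h.2 i j (hr i j hle.1) hle.2,
    fun i j hb hle => ⟨rel_of_sameBlock_restrict hb, h.1 i j hle⟩⟩

/-- `i` and `j` lie in a common block of `F₁` or of `F₂`. -/
def blockRel (F₁ F₂ : Forest I) (i j : I) : Prop := F₁.sameBlock i j ∨ F₂.sameBlock i j

/-- `i` is the root of the block of `j` in `F₁` or in `F₂`. -/
def rootRel (F₁ F₂ : Forest I) (i j : I) : Prop :=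
  (F₁.IsRoot i ∧ F₁.le i j) ∨ (F₂.IsRoot i ∧ F₂.le i j)

/-- If no vertex is a node of both forests, the set of vertices reached from a common root
is closed under passing to the root of a block. -/
theorem reflTransGen_rootRel_of_rootRel {F₁ F₂ : Forest I} (hdisj : F₁.nodes ∩ F₂.nodes = ∅)
    {i : I} (h₁ : F₁.IsRoot i) (h₂ : F₂.IsRoot i) {k r : I}
    (hk : Relation.ReflTransGen (rootRel F₁ F₂) i k) (hr : rootRel F₁ F₂ r k) :
    Relation.ReflTransGen (rootRel F₁ F₂) i r := by
  have root_or (k : I) : F₁.IsRoot k ∨ F₂.IsRoot k := by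
    by_contra! h
    have hmem : k ∈ F₁.nodes ∩ F₂.nodes :=
      ⟨by_contra fun hn => h.1 (isRoot_of_notMem_nodes hn),
        by_contra fun hn => h.2 (isRoot_of_notMem_nodes hn)⟩
    simp [hdisj] at hmem
  induction hk with
  | refl =>
    rcases hr with ⟨-, hr⟩ | ⟨-, hr⟩
    · rw [h₁ r hr]
    · rw [h₂ r hr]
  | @tail a k ha hak ih =>
    have hk := ha.tail hak
    rcases hak with ⟨har, hle⟩ | ⟨har, hle⟩ <;> rcases hr with ⟨hr, hrk⟩ | ⟨hr, hrk⟩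
    · rwa [hr.eq_of_le har hrk hle]
    · rcases root_or k with h | h
      · obtain rfl := h a hle
        exact ih (Or.inr ⟨hr, hrk⟩)
      · rwa [h r hrk]
    · rcases root_or k with h | h
      · rwa [h r hrk]
      · obtain rfl := h a hle
        exact ih (Or.inl ⟨hr, hrk⟩)
    · rwa [hr.eq_of_le har hrk hle]

theorem reflTransGen_rootRel_of_blockRel {F₁ F₂ : Forest I} (hdisj : F₁.nodes ∩ F₂.nodes = ∅)
    {i : I} (h₁ : F₁.IsRoot i) (h₂ : F₂.IsRoot i) {k l : I} (hkl : blockRel F₁ F₂ k l)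
    (hk : Relation.ReflTransGen (rootRel F₁ F₂) i k) :
    Relation.ReflTransGen (rootRel F₁ F₂) i l := by
  rcases hkl with ⟨r, hr, hrk, hrl⟩ | ⟨r, hr, hrk, hrl⟩
  · exact (reflTransGen_rootRel_of_rootRel hdisj h₁ h₂ hk (Or.inl ⟨hr, hrk⟩)).tail
      (Or.inl ⟨hr, hrl⟩)
  · exact (reflTransGen_rootRel_of_rootRel hdisj h₁ h₂ hk (Or.inr ⟨hr, hrk⟩)).tail
      (Or.inr ⟨hr, hrl⟩)

theorem reflTransGen_rootRel_of_eqvGen {F₁ F₂ : Forest I} (hdisj : F₁.nodes ∩ F₂.nodes = ∅)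
    {i : I} (h₁ : F₁.IsRoot i) (h₂ : F₂.IsRoot i) {j : I}
    (h : Relation.EqvGen (blockRel F₁ F₂) i j) :
    Relation.ReflTransGen (rootRel F₁ F₂) i j := by
  have key (k l : I) (hkl : Relation.EqvGen (blockRel F₁ F₂) k l) :
      Relation.ReflTransGen (rootRel F₁ F₂) i k ↔ Relation.ReflTransGen (rootRel F₁ F₂) i l := by
    induction hkl with
    | rel k l hkl =>
      exact ⟨reflTransGen_rootRel_of_blockRel hdisj h₁ h₂ hkl,
        reflTransGen_rootRel_of_blockRel hdisj h₁ h₂ (hkl.imp sameBlock.symm sameBlock.symm)⟩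
    | refl => rfl
    | symm _ _ _ ih => exact ih.symm
    | trans _ _ _ _ _ ih ih' => exact ih.trans ih'
  exact (key i j h).1 .refl

theorem le_of_reflTransGen_rootRel {T F₁ F₂ : Forest I} (h₁ : F₁.Sub T) (h₂ : F₂.Sub T)
    {i j : I} (h : Relation.ReflTransGen (rootRel F₁ F₂) i j) : T.le i j := by
  induction h with
  | refl => exact T.le_refl i
  | tail _ hstep ih =>
    exact T.le_trans ih (hstep.elim (fun h => h₁.1 _ _ h.2) fun h => h₂.1 _ _ h.2)

end Forest

/-- if `F₁ ⊆ T`, `F₂ ⊆ T` and `N(F₁) ∩ N(F₂) = ∅`, then the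
supremum `F` of `F₁` and `F₂` in the lattice of forests `⊆ T` exists and
satisfies `N(F) = N(F₁) ⊔ N(F₂)`. -/
theorem nodes_of_sup {I : Type*} [Finite I] (T : Forest I) (hT : T.IsTree)
    (F₁ F₂ : Forest I) (h₁ : F₁.Sub T) (h₂ : F₂.Sub T)
    (hdisj : F₁.nodes ∩ F₂.nodes = ∅) :
    ∃ F : Forest I, F.Sub T ∧ F₁.Sub F ∧ F₂.Sub F ∧
      F.nodes = F₁.nodes ∪ F₂.nodes ∧
      ∀ G : Forest I, G.Sub T → F₁.Sub G → F₂.Sub G → F.Sub G := by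
  let r : Setoid I := Relation.EqvGen.setoid (Forest.blockRel F₁ F₂)
  have hF₁ : F₁.Sub (T.restrict r) := h₁.sub_restrict fun i j h => .rel i j (Or.inl h)
  have hF₂ : F₂.Sub (T.restrict r) := h₂.sub_restrict fun i j h => .rel i j (Or.inr h)
  refine ⟨T.restrict r, T.restrict_sub r, hF₁, hF₂, Set.Subset.antisymm ?_
    (Set.union_subset (Forest.nodes_subset_of_le hF₁.1) (Forest.nodes_subset_of_le hF₂.1)), ?_⟩
  · rintro i ⟨j, ⟨hr, hle⟩, hne⟩
    by_contra hi
    rw [Set.mem_union, not_or] at hi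
    exact hne (T.le_antisymm hle (Forest.le_of_reflTransGen_rootRel h₁ h₂
      (Forest.reflTransGen_rootRel_of_eqvGen hdisj (Forest.isRoot_of_notMem_nodes hi.1)
        (Forest.isRoot_of_notMem_nodes hi.2) (r.symm hr))))
  · refine fun G hG hG₁ hG₂ => hG.restrict_sub fun i j hij => ?_
    induction hij with
    | rel i j h => exact h.elim hG₁.sameBlock_mono hG₂.sameBlock_mono
    | refl i => exact Forest.sameBlock_of_le_of_le (G.le_refl i) (G.le_refl i)
    | symm _ _ _ ih => exact ih.symm
    | trans _ _ _ _ _ ih ih' => exact ih.trans ih'
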